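/- Let s > 1/2 and let u ∈ 𝒮'(ℝ^d) be the tempered distribution given by the constant function 1, u(φ) = ∫_{ℝ^d} φ(x) dx. Then for any window φ ∈ Σ_s(ℝ^d) \ {0}, WF^s(1) = (ℝ^d \ {0}) × {0}; that is, a point (x₀,ξ₀) ∈ ℝ^{2d} \ {0} belongs to WF^s(1) if and only if ξ₀ = 0 and x₀ ≠ 0. -/

import Mathlib

open MeasureTheory Filter
open scoped BigOperators ENNReal RealInnerProductSpace

noncomputable section

/-- `ℝ^d` with the Euclidean norm. -/
abbrev Ed (d : ℕ) : Type := EuclideanSpace ℝ (Fin d)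

/-- Partial derivative along the `i`-th coordinate direction. -/
def pdGS {d : ℕ} (i : Fin d) (f : Ed d → ℂ) : Ed d → ℂ :=
  fun x => fderiv ℝ f x (EuclideanSpace.single i 1)

/-- Multi-index partial derivative `∂^β`. -/
def mderiv {d : ℕ} (β : Fin d → ℕ) (f : Ed d → ℂ) : Ed d → ℂ :=
  ((List.ofFn fun i : Fin d => (pdGS i)^[β i]).foldr (· ∘ ·) id) f

/-- Monomial `x^α`. -/
def mpow {d : ℕ} (x : Ed d) (α : Fin d → ℕ) : ℝ := ∏ i, x i ^ α i

/-- Multi-index factorial `α!`. -/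
def mfact {d : ℕ} (α : Fin d → ℕ) : ℕ := ∏ i, Nat.factorial (α i)

/-- Multi-index length `|α|`. -/
def mlen {d : ℕ} (α : Fin d → ℕ) : ℕ := ∑ i, α i

/-- The Gelfand–Shilov seminorm `‖f‖_{S_{s,h}}`, valued in `[0,∞]`. -/
def GSnorm {d : ℕ} (s h : ℝ) (f : Ed d → ℂ) : ℝ≥0∞ :=
  ⨆ (x : Ed d) (α : Fin d → ℕ) (β : Fin d → ℕ),
    ENNReal.ofReal (|mpow x α| * ‖mderiv β f x‖ /
      (h ^ (mlen α + mlen β) * ((mfact α : ℝ) * (mfact β : ℝ)) ^ s))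

/-- The Gelfand–Shilov space `Σ_s(ℝ^d)`: smooth functions all of whose
`S_{s,h}` seminorms are finite. -/
def SigmaGS (s : ℝ) (d : ℕ) : Set (Ed d → ℂ) :=
  {f | ContDiff ℝ ((⊤ : ℕ∞) : WithTop ℕ∞) f ∧ ∀ h : ℝ, 0 < h → GSnorm s h f < ⊤}

/-- The seminorm `|f|_A`, valued in `[0,∞]`. -/
def GSnormA {d : ℕ} (s A : ℝ) (f : Ed d → ℂ) : ℝ≥0∞ :=
  ⨆ (x : Ed d) (β : Fin d → ℕ),
    ENNReal.ofReal (A ^ mlen β * Real.exp (A * ‖x‖ ^ (1/s)) * ‖mderiv β f x‖ /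
      (mfact β : ℝ) ^ s)

/-- The Fourier transform `f̂(ξ) = ∫ f(x) e^{-i⟨x,ξ⟩} dx`. -/
def FTgs {d : ℕ} (f : Ed d → ℂ) (ξ : Ed d) : ℂ :=
  ∫ x : Ed d, f x * Complex.exp (-(Complex.I * (⟪x, ξ⟫ : ℝ)))

/-- The short-time Fourier transform of a function `f` with window `φ`. -/
def STFTgs {d : ℕ} (φ f : Ed d → ℂ) (z : Ed d × Ed d) : ℂ :=
  ∫ y : Ed d, f y * (starRingEnd ℂ) (φ (y - z.1)) * Complex.exp (-(Complex.I * (⟪y, z.2⟫ : ℝ)))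

/-- Euclidean norm of a phase-space point `(x,ξ) ∈ ℝ^{2d}`. -/
def pnorm {d : ℕ} (z : Ed d × Ed d) : ℝ := Real.sqrt (‖z.1‖ ^ 2 + ‖z.2‖ ^ 2)

/-- A conic subset: invariant under multiplication by positive reals. -/
def IsConic {V : Type*} [SMul ℝ V] (Γ : Set V) : Prop :=
  ∀ t : ℝ, 0 < t → ∀ z ∈ Γ, t • z ∈ Γ

/-- Tempered distributions on `ℝ^d`. -/
abbrev TD (d : ℕ) : Type := SchwartzMap (Ed d) ℂ →L[ℂ] ℂ

/-- `W` is the short-time Fourier transform `V_φ u` of the tempered distribution `u`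
with respect to the window `φ`. -/
def IsSTFT {d : ℕ} (u : TD d) (φ : Ed d → ℂ) (W : Ed d × Ed d → ℂ) : Prop :=
  ∀ (x ξ : Ed d) (g : SchwartzMap (Ed d) ℂ),
    (∀ y : Ed d, g y = (starRingEnd ℂ) (φ (y - x)) * Complex.exp (-(Complex.I * (⟪y, ξ⟫ : ℝ)))) →
    W (x, ξ) = u g

/-- The `s`-Gelfand–Shilov wave front set of a distribution whose short-time Fourier
transform is `W`: the set of nonzero phase-space points having no open conic
neighbourhood on which `e^{A|z|^{1/s}} |W(z)|` is bounded for every `A > 0`. -/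
def WFs {d : ℕ} (s : ℝ) (W : Ed d × Ed d → ℂ) : Set (Ed d × Ed d) :=
  {z₀ | z₀ ≠ 0 ∧ ¬ ∃ Γ : Set (Ed d × Ed d), IsOpen Γ ∧ IsConic Γ ∧
    (0 : Ed d × Ed d) ∉ Γ ∧ z₀ ∈ Γ ∧
    ∀ A : ℝ, 0 < A → ∃ C : ℝ, ∀ z ∈ Γ, Real.exp (A * pnorm z ^ (1/s)) * ‖W z‖ ≤ C}

/-- The real quadratic form `⟨Bx, x⟩` of a matrix `B`. -/
def qf {d : ℕ} (B : Matrix (Fin d) (Fin d) ℝ) (x : Ed d) : ℝ :=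
  ∑ i, (∑ j, B i j * x j) * x i

/-- Tempered distributions on `ℝ^m × ℝ^n`. -/
abbrev TD2 (m n : ℕ) : Type := SchwartzMap (Ed m × Ed n) ℂ →L[ℂ] ℂ

/-- Short-time Fourier transform of a tempered distribution on `ℝ^m × ℝ^n`. -/
def IsSTFT2 {m n : ℕ} (w : TD2 m n) (Φ : Ed m × Ed n → ℂ)
    (W : (Ed m × Ed n) × (Ed m × Ed n) → ℂ) : Prop :=
  ∀ (x ξ : Ed m × Ed n) (g : SchwartzMap (Ed m × Ed n) ℂ),
    (∀ y : Ed m × Ed n, g y = (starRingEnd ℂ) (Φ (y - x)) *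
      Complex.exp (-(Complex.I * ((⟪y.1, ξ.1⟫ + ⟪y.2, ξ.2⟫ : ℝ))))) →
    W (x, ξ) = w g

/-- Euclidean norm of a phase-space point of `T^*(ℝ^m × ℝ^n)`. -/
def pnorm2 {m n : ℕ} (z : (Ed m × Ed n) × (Ed m × Ed n)) : ℝ :=
  Real.sqrt (‖z.1.1‖ ^ 2 + ‖z.1.2‖ ^ 2 + ‖z.2.1‖ ^ 2 + ‖z.2.2‖ ^ 2)

/-- The `s`-Gelfand–Shilov wave front set on `ℝ^m × ℝ^n`. -/
def WFs2 {m n : ℕ} (s : ℝ) (W : (Ed m × Ed n) × (Ed m × Ed n) → ℂ) :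
    Set ((Ed m × Ed n) × (Ed m × Ed n)) :=
  {z₀ | z₀ ≠ 0 ∧ ¬ ∃ Γ : Set ((Ed m × Ed n) × (Ed m × Ed n)), IsOpen Γ ∧ IsConic Γ ∧
    (0 : (Ed m × Ed n) × (Ed m × Ed n)) ∉ Γ ∧ z₀ ∈ Γ ∧
    ∀ A : ℝ, 0 < A → ∃ C : ℝ, ∀ z ∈ Γ, Real.exp (A * pnorm2 z ^ (1/s)) * ‖W z‖ ≤ C}

open scoped ContDiff SchwartzMap FourierTransform LineDeriv

section MultiIndex

variable {d : ℕ}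

lemma contDiff_pdGS {f : Ed d → ℂ} (hf : ContDiff ℝ ∞ f) (i : Fin d) : ContDiff ℝ ∞ (pdGS i f) :=
  (hf.fderiv_right (m := ∞) (by simp)).clm_apply contDiff_const

lemma contDiff_iterate_pdGS {f : Ed d → ℂ} (hf : ContDiff ℝ ∞ f) (i : Fin d) (n : ℕ) :
    ContDiff ℝ ∞ ((pdGS i)^[n] f) := by
  induction n with
  | zero => exact hf
  | succ n ih => rw [Function.iterate_succ_apply']; exact contDiff_pdGS ih i

lemma pdGS_comm {f : Ed d → ℂ} (hf : ContDiff ℝ ∞ f) (i j : Fin d) :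
    pdGS i (pdGS j f) = pdGS j (pdGS i f) := by
  have hd : Differentiable ℝ (fderiv ℝ f) :=
    (hf.fderiv_right (m := ∞) (by simp)).differentiable (by simp)
  have key (k : Fin d) (v x : Ed d) : fderiv ℝ (pdGS k f) x v =
      fderiv ℝ (fderiv ℝ f) x v (EuclideanSpace.single k 1) := by
    have := ((hd x).hasFDerivAt.clm_apply
      (hasFDerivAt_const (EuclideanSpace.single k (1 : ℝ)) x)).fderiv
    change fderiv ℝ (fun y => fderiv ℝ f y (EuclideanSpace.single k 1)) x v = _
    rw [this]
    simp
  ext x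
  have hsymm : IsSymmSndFDerivAt ℝ f x :=
    hf.contDiffAt.isSymmSndFDerivAt (by
      simpa using WithTop.coe_le_coe.mpr (le_top : (2 : ℕ∞) ≤ ⊤))
  change fderiv ℝ (pdGS j f) x _ = fderiv ℝ (pdGS i f) x _
  rw [key, key]
  exact hsymm _ _

lemma pdGS_iterate_comm {f : Ed d → ℂ} (hf : ContDiff ℝ ∞ f) (i j : Fin d) (n : ℕ) :
    pdGS i ((pdGS j)^[n] f) = (pdGS j)^[n] (pdGS i f) := by
  induction n with
  | zero => rfl
  | succ n ih =>
    rw [Function.iterate_succ_apply', pdGS_comm (contDiff_iterate_pdGS hf j n), ih,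
      ← Function.iterate_succ_apply' (pdGS j)]

/-- The derivative `∂^β` restricted to the coordinates occurring in a list. -/
def listDeriv (l : List (Fin d)) (β : Fin d → ℕ) (f : Ed d → ℂ) : Ed d → ℂ :=
  ((l.map fun i => (pdGS i)^[β i]).foldr (· ∘ ·) id) f

lemma mderiv_eq_listDeriv (β : Fin d → ℕ) (f : Ed d → ℂ) :
    mderiv β f = listDeriv (List.finRange d) β f := by
  rw [mderiv, listDeriv, List.ofFn_eq_map]

lemma listDeriv_cons (j : Fin d) (l : List (Fin d)) (β : Fin d → ℕ) (f : Ed d → ℂ) :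
    listDeriv (j :: l) β f = (pdGS j)^[β j] (listDeriv l β f) := rfl

lemma contDiff_listDeriv {f : Ed d → ℂ} (hf : ContDiff ℝ ∞ f) (l : List (Fin d))
    (β : Fin d → ℕ) : ContDiff ℝ ∞ (listDeriv l β f) := by
  induction l with
  | nil => exact hf
  | cons j l ih => rw [listDeriv_cons]; exact contDiff_iterate_pdGS ih j _

lemma pdGS_listDeriv {f : Ed d → ℂ} (hf : ContDiff ℝ ∞ f) (i : Fin d) (l : List (Fin d))
    (β : Fin d → ℕ) : pdGS i (listDeriv l β f) = listDeriv l β (pdGS i f) := by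
  induction l with
  | nil => rfl
  | cons j l ih =>
    rw [listDeriv_cons, listDeriv_cons, pdGS_iterate_comm (contDiff_listDeriv hf l β), ih]

lemma listDeriv_congr {l : List (Fin d)} {β γ : Fin d → ℕ} (h : ∀ i ∈ l, β i = γ i)
    (f : Ed d → ℂ) : listDeriv l β f = listDeriv l γ f := by
  rw [listDeriv, listDeriv, List.map_congr_left fun i hi => by rw [h i hi]]

lemma listDeriv_add_single {f : Ed d → ℂ} (hf : ContDiff ℝ ∞ f) {i : Fin d} {l : List (Fin d)}
    (hl : l.Nodup) (hi : i ∈ l) (β : Fin d → ℕ) :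
    listDeriv l (β + Pi.single i 1) f = listDeriv l β (pdGS i f) := by
  induction l with
  | nil => simp at hi
  | cons j l ih =>
    rw [List.nodup_cons] at hl
    rw [listDeriv_cons, listDeriv_cons]
    by_cases hij : i = j
    · subst hij
      rw [listDeriv_congr (β := β + Pi.single i 1) (γ := β), ← pdGS_listDeriv hf]
      · simp
      · intro k hk
        have : k ≠ i := fun h => hl.1 (h ▸ hk)
        simp [this]
    · rw [ih hl.2 (by simpa [hij] using hi)]
      simp [Ne.symm hij]

lemma mderiv_add_single {f : Ed d → ℂ} (hf : ContDiff ℝ ∞ f) (i : Fin d) (β : Fin d → ℕ) :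
    mderiv (β + Pi.single i 1) f = mderiv β (pdGS i f) := by
  rw [mderiv_eq_listDeriv, mderiv_eq_listDeriv,
    listDeriv_add_single hf (List.nodup_finRange d) (List.mem_finRange i)]

lemma mderiv_zero (f : Ed d → ℂ) : mderiv 0 f = f := by
  rw [mderiv_eq_listDeriv]
  induction List.finRange d with
  | nil => rfl
  | cons j l ih => rw [listDeriv_cons, ih]; rfl

lemma mderiv_single {f : Ed d → ℂ} (hf : ContDiff ℝ ∞ f) (i : Fin d) (n : ℕ) :
    mderiv (Pi.single i n) f = (pdGS i)^[n] f := by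
  induction n generalizing f with
  | zero => simp [mderiv_zero]
  | succ n ih =>
    rw [Pi.single_add, mderiv_add_single hf, ih (contDiff_pdGS hf i), Function.iterate_succ_apply]

lemma mpow_zero (x : Ed d) : mpow x 0 = 1 := by simp [mpow]

lemma mpow_single (x : Ed d) (j : Fin d) (n : ℕ) : mpow x (Pi.single j n) = x j ^ n := by
  rw [mpow, Finset.prod_eq_single j]
  · simp
  · intro b _ hb
    simp [hb]
  · simp

lemma mfact_zero : mfact (0 : Fin d → ℕ) = 1 := by simp [mfact]

lemma mfact_single (j : Fin d) (n : ℕ) : mfact (Pi.single j n) = n.factorial := by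
  rw [mfact, Finset.prod_eq_single j]
  · simp
  · intro b _ hb
    simp [hb]
  · simp

lemma mlen_zero : mlen (0 : Fin d → ℕ) = 0 := by simp [mlen]

lemma mlen_single (j : Fin d) (n : ℕ) : mlen (Pi.single j n) = n := by
  simp [mlen]

end MultiIndex

section Decay

variable {d : ℕ}

lemma eq_zero_or_exists_norm_le_mul_abs_coord (x : Ed d) :
    x = 0 ∨ ∃ j, ‖x‖ ≤ d * |x j| := by
  rcases isEmpty_or_nonempty (Fin d) with h | h
  · exact Or.inl (Subsingleton.elim _ _)
  · obtain ⟨j, hj⟩ := Finite.exists_max fun i => |x i|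
    refine Or.inr ⟨j, ?_⟩
    have hx : x = ∑ i, x i • EuclideanSpace.single i (1 : ℝ) := by
      ext k
      simp [Pi.single_apply]
    calc ‖x‖ = ‖∑ i, x i • EuclideanSpace.single i (1 : ℝ)‖ := by rw [← hx]
      _ ≤ ∑ i, ‖x i • EuclideanSpace.single i (1 : ℝ)‖ := norm_sum_le _ _
      _ = ∑ i, |x i| := by simp [norm_smul]
      _ ≤ ∑ _i : Fin d, |x j| := Finset.sum_le_sum fun i _ => hj i
      _ = d * |x j| := by simp

lemma one_add_norm_pow_mul_le {x : Ed d} {N : ℕ} {a b c : ℝ} (hc : 0 ≤ c) (hb : 0 ≤ b)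
    (ha : c ≤ a) (h : ∀ j, |x j| ^ N * c ≤ b) :
    (1 + ‖x‖) ^ N * c ≤ (1 + d) ^ N * (a + b) := by
  have h1 : (1 : ℝ) ≤ (1 + d) ^ N := one_le_pow₀ (by simp)
  rcases eq_zero_or_exists_norm_le_mul_abs_coord x with rfl | ⟨j, hj⟩
  · simp only [norm_zero, add_zero, one_pow, one_mul]
    nlinarith
  · rcases le_total |x j| 1 with hle | hle
    · have : (1 + ‖x‖) ^ N ≤ (1 + d) ^ N := by
        gcongr
        nlinarith [Nat.cast_nonneg (α := ℝ) d]
      calc _ ≤ (1 + d) ^ N * c := by gcongr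
        _ ≤ _ := by gcongr; linarith
    · have : (1 + ‖x‖) ^ N ≤ (1 + d) ^ N * |x j| ^ N := by
        rw [← mul_pow]
        gcongr
        nlinarith
      calc _ ≤ (1 + d) ^ N * |x j| ^ N * c := by gcongr
        _ = (1 + d) ^ N * (|x j| ^ N * c) := by ring
        _ ≤ _ := by gcongr; linarith [h j]

lemma fderiv_eq_sum_pdGS (f : Ed d → ℂ) :
    fderiv ℝ f = fun x => ∑ i,
      (ContinuousLinearMap.smulRightL ℝ (Ed d) ℂ (EuclideanSpace.proj i) ∘ pdGS i f) x := by
  ext x v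
  have hv : v = ∑ i, v i • EuclideanSpace.single i (1 : ℝ) := by
    ext k
    simp [Pi.single_apply]
  conv_lhs => rw [hv]
  simp [pdGS]

lemma decay_of_bounded_mpow_mul_mderiv (k n : ℕ) {f : Ed d → ℂ} (hf : ContDiff ℝ ∞ f)
    (h : ∀ α β : Fin d → ℕ, ∃ C, ∀ x, |mpow x α| * ‖mderiv β f x‖ ≤ C) :
    ∃ C, ∀ x, ‖x‖ ^ k * ‖iteratedFDeriv ℝ n f x‖ ≤ C := by
  induction n generalizing f with
  | zero =>
    obtain ⟨a, ha⟩ := h 0 0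
    choose b hb using fun j => h (Pi.single j k) 0
    simp only [mderiv_zero, mpow_zero, mpow_single, abs_one, one_mul, abs_pow] at ha hb
    refine ⟨(1 + d) ^ k * (a + ∑ j, |b j|), fun x => ?_⟩
    rw [norm_iteratedFDeriv_zero]
    calc _ ≤ (1 + ‖x‖) ^ k * ‖f x‖ := by gcongr; simp
      _ ≤ _ := one_add_norm_pow_mul_le (norm_nonneg _) (by positivity) (ha x) fun j =>
        (hb j x).trans ((le_abs_self _).trans
          (Finset.single_le_sum (f := fun j => |b j|) (fun _ _ => abs_nonneg _)
            (Finset.mem_univ j)))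
  | succ n ih =>
    choose C hC using fun i : Fin d => ih (contDiff_pdGS hf i) fun α β => by
      rw [← mderiv_add_single hf]; exact h α (β + Pi.single i 1)
    let L (i : Fin d) := ContinuousLinearMap.smulRightL ℝ (Ed d) ℂ (EuclideanSpace.proj i)
    refine ⟨∑ i, ‖L i‖ * C i, fun x => ?_⟩
    have hsmooth (i : Fin d) : ContDiff ℝ ∞ (L i ∘ pdGS i f) :=
      (L i).contDiff.comp (contDiff_pdGS hf i)
    rw [← norm_iteratedFDeriv_fderiv, fderiv_eq_sum_pdGS,
      iteratedFDeriv_sum (fun i _ => (hsmooth i).of_le (by exact_mod_cast le_top)),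
      Finset.sum_apply]
    calc _ ≤ ‖x‖ ^ k * ∑ i, ‖L i‖ * ‖iteratedFDeriv ℝ n (pdGS i f) x‖ := by
          gcongr
          refine (norm_sum_le _ _).trans (Finset.sum_le_sum fun i _ => ?_)
          exact (L i).norm_iteratedFDeriv_comp_left (contDiff_pdGS hf i).contDiffAt
            (by exact_mod_cast le_top)
      _ = ∑ i, ‖L i‖ * (‖x‖ ^ k * ‖iteratedFDeriv ℝ n (pdGS i f) x‖) := by
          rw [Finset.mul_sum]
          exact Finset.sum_congr rfl fun i _ => by ring
      _ ≤ _ := by gcongr with i; exact hC i x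

lemma exists_bound_of_GSnorm_lt_top {s h : ℝ} (hh : 0 < h) {f : Ed d → ℂ}
    (hf : GSnorm s h f < ⊤) : ∃ M, 0 ≤ M ∧ ∀ (x : Ed d) (α β : Fin d → ℕ),
      |mpow x α| * ‖mderiv β f x‖ ≤
        M * (h ^ (mlen α + mlen β) * ((mfact α : ℝ) * (mfact β : ℝ)) ^ s) := by
  refine ⟨(GSnorm s h f).toReal, ENNReal.toReal_nonneg, fun x α β => ?_⟩
  have hpos (α : Fin d → ℕ) : 0 < (mfact α : ℝ) := by
    exact_mod_cast Finset.prod_pos fun i _ => Nat.factorial_pos (α i)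
  have h0 : 0 < h ^ (mlen α + mlen β) * ((mfact α : ℝ) * (mfact β : ℝ)) ^ s := by
    have := hpos α
    have := hpos β
    positivity
  rw [← div_le_iff₀ h0]
  refine (ENNReal.ofReal_le_iff_le_toReal hf.ne).mp ?_
  exact le_iSup_of_le x (le_iSup_of_le α (le_iSup_of_le β le_rfl))

/-- A function in `Σ_s` is a Schwartz function. -/
def SigmaGS.toSchwartzMap {s : ℝ} {f : Ed d → ℂ} (hf : f ∈ SigmaGS s d) : 𝓢(Ed d, ℂ) where
  toFun := f
  smooth' := hf.1
  decay' k n := decay_of_bounded_mpow_mul_mderiv k n hf.1 fun α β => by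
    obtain ⟨M, -, hM⟩ := exists_bound_of_GSnorm_lt_top one_pos (hf.2 1 one_pos)
    exact ⟨_, fun x => hM x α β⟩

end Decay

section FourierTransform

variable {d : ℕ}

lemma hasTemperateGrowth_exp_neg_I_mul :
    (fun t : ℝ => Complex.exp (-(Complex.I * (t : ℂ)))).HasTemperateGrowth := by
  have hderiv (n : ℕ) : iteratedDeriv n (fun t : ℝ => Complex.exp (-(Complex.I * (t : ℂ)))) =
      fun t : ℝ => (-Complex.I) ^ n * Complex.exp (-(Complex.I * (t : ℂ))) := by
    induction n with
    | zero => simp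
    | succ n ih =>
      rw [iteratedDeriv_succ, ih]
      ext t
      have h1 : HasDerivAt (fun t : ℝ => -(Complex.I * (t : ℂ))) (-(Complex.I * 1)) t :=
        ((Complex.ofRealCLM.hasDerivAt (x := t)).const_mul Complex.I).neg
      rw [(h1.cexp.const_mul _).deriv]
      ring
  refine ⟨?_, fun n => ⟨0, 1, fun t => ?_⟩⟩
  · exact (contDiff_const.mul Complex.ofRealCLM.contDiff).neg.cexp
  · rw [norm_iteratedFDeriv_eq_norm_iteratedDeriv, hderiv]
    simp [Complex.norm_exp]

lemma hasTemperateGrowth_exp_neg_I_mul_inner (ξ : Ed d) :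
    (fun y : Ed d => Complex.exp (-(Complex.I * (⟪y, ξ⟫ : ℝ)))).HasTemperateGrowth :=
  hasTemperateGrowth_exp_neg_I_mul.comp (Function.hasTemperateGrowth_inner_left ξ)

lemma norm_integral_conj_mul_exp (f : Ed d → ℂ) (x ξ : Ed d) :
    ‖∫ y, (starRingEnd ℂ) (f (y - x)) * Complex.exp (-(Complex.I * (⟪y, ξ⟫ : ℝ)))‖ =
      ‖𝓕 f (-(2 * Real.pi)⁻¹ • ξ)‖ := by
  have h1 (y : Ed d) : (starRingEnd ℂ) (f (y - x)) * Complex.exp (-(Complex.I * (⟪y, ξ⟫ : ℝ))) =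
      (starRingEnd ℂ) (f (y - x) * Complex.exp (Complex.I * (⟪y, ξ⟫ : ℝ))) := by
    rw [map_mul, ← Complex.exp_conj]
    simp
  have h2 : ∫ y, f (y - x) * Complex.exp (Complex.I * (⟪y, ξ⟫ : ℝ)) =
      Complex.exp (Complex.I * (⟪x, ξ⟫ : ℝ)) * 𝓕 f (-(2 * Real.pi)⁻¹ • ξ) := by
    rw [← integral_add_right_eq_self _ x, Real.fourier_eq', ← integral_const_mul]
    refine integral_congr_ae (.of_forall fun y => ?_)
    simp only [add_sub_cancel_right, inner_add_left, smul_eq_mul, inner_smul_right]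
    have : -2 * Real.pi * (-(2 * Real.pi)⁻¹ * ⟪y, ξ⟫) = (⟪y, ξ⟫ : ℝ) := by
      field_simp
    rw [this, ← mul_assoc, ← Complex.exp_add, mul_comm]
    congr 2
    push_cast
    ring
  simp_rw [h1]
  rw [integral_conj, RCLike.norm_conj, h2, norm_mul, mul_comm Complex.I,
    Complex.norm_exp_ofReal_mul_I, one_mul]

lemma norm_STFT_one {u : TD d} (hu : ∀ g : 𝓢(Ed d, ℂ), u g = ∫ x : Ed d, g x)
    (Φ : 𝓢(Ed d, ℂ)) {W : Ed d × Ed d → ℂ} (hW : IsSTFT u Φ W) (z : Ed d × Ed d) :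
    ‖W z‖ = ‖(𝓕 Φ) (-(2 * Real.pi)⁻¹ • z.2)‖ := by
  obtain ⟨x, ξ⟩ := z
  let g : 𝓢(Ed d, ℂ) := SchwartzMap.smulLeftCLM ℂ
    (fun y : Ed d => Complex.exp (-(Complex.I * (⟪y, ξ⟫ : ℝ))))
    ((Φ.compSubConstCLM ℝ x).postcompCLM (Complex.conjCLE : ℂ →L[ℝ] ℂ))
  have hg (y : Ed d) : g y =
      (starRingEnd ℂ) (Φ (y - x)) * Complex.exp (-(Complex.I * (⟪y, ξ⟫ : ℝ))) := by
    rw [SchwartzMap.smulLeftCLM_apply_apply (hasTemperateGrowth_exp_neg_I_mul_inner ξ)]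
    simp [mul_comm]
  rw [hW x ξ g hg, hu, integral_congr_ae (.of_forall hg), norm_integral_conj_mul_exp]
  rfl

lemma iterate_lineDerivOp_eq_iterate_pdGS (Φ : 𝓢(Ed d, ℂ)) (i : Fin d) (n : ℕ) :
    ⇑((fun F : 𝓢(Ed d, ℂ) => ∂_{EuclideanSpace.single i (1 : ℝ)} F)^[n] Φ) =
      (pdGS i)^[n] Φ := by
  induction n with
  | zero => rfl
  | succ n ih =>
    rw [Function.iterate_succ_apply', Function.iterate_succ_apply', ← ih]
    rfl

lemma norm_fourier_iterate_lineDerivOp (Φ : 𝓢(Ed d, ℂ)) (i : Fin d) (n : ℕ) (η : Ed d) :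
    ‖(𝓕 ((fun F : 𝓢(Ed d, ℂ) => ∂_{EuclideanSpace.single i (1 : ℝ)} F)^[n] Φ)) η‖ =
      (2 * Real.pi * |η i|) ^ n * ‖(𝓕 Φ) η‖ := by
  induction n with
  | zero => simp
  | succ n ih =>
    rw [Function.iterate_succ_apply', SchwartzMap.fourier_lineDerivOp_eq, _root_.smul_apply,
      SchwartzMap.smulLeftCLM_apply_apply (Function.hasTemperateGrowth_inner_left _), norm_smul,
      norm_smul, ih]
    simp [abs_of_pos Real.pi_pos, EuclideanSpace.inner_single_right]
    ring

lemma exists_fourier_bound {s h : ℝ} (hh : 0 < h) (Φ : 𝓢(Ed d, ℂ))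
    (hf : GSnorm s h (Φ : Ed d → ℂ) < ⊤) :
    ∃ C, 0 < C ∧ ∀ (i : Fin d) (n : ℕ) (η : Ed d),
      (2 * Real.pi * |η i|) ^ n * ‖(𝓕 Φ) η‖ ≤ C * (h ^ n * (n.factorial : ℝ) ^ s) := by
  obtain ⟨M, hM0, hM⟩ := exists_bound_of_GSnorm_lt_top hh hf
  set N := d + 1 with hN
  let B : ℝ := h ^ N * (N.factorial : ℝ) ^ s
  have hB : 0 ≤ B := by positivity
  have hint : Integrable fun x : Ed d => (1 + ‖x‖) ^ (-(N : ℝ)) :=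
    integrable_one_add_norm (by simp [hN])
  let J : ℝ := ∫ x : Ed d, (1 + ‖x‖) ^ (-(N : ℝ))
  have hJ : 0 ≤ J := integral_nonneg fun x => by positivity
  refine ⟨(1 + d) ^ N * (M + M * B) * J + 1, by positivity, fun i n η => ?_⟩
  rw [← norm_fourier_iterate_lineDerivOp]
  set F := (fun F : 𝓢(Ed d, ℂ) => ∂_{EuclideanSpace.single i (1 : ℝ)} F)^[n] Φ with hF
  have hFm : (F : Ed d → ℂ) = mderiv (Pi.single i n) Φ := by
    rw [mderiv_single (Φ.smooth ⊤), hF, iterate_lineDerivOp_eq_iterate_pdGS]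
  set D : ℝ := h ^ n * (n.factorial : ℝ) ^ s with hD
  have hD0 : 0 ≤ D := by positivity
  have hFbound (x : Ed d) : (1 + ‖x‖) ^ N * ‖F x‖ ≤ (1 + d) ^ N * (M * D + M * B * D) := by
    refine one_add_norm_pow_mul_le (norm_nonneg _) (by positivity) ?_ fun j => ?_
    · simpa [mpow_zero, mlen_zero, mfact_zero, mlen_single, mfact_single, ← hFm] using
        hM x 0 (Pi.single i n)
    · have := hM x (Pi.single j N) (Pi.single i n)
      rw [mpow_single, mlen_single, mlen_single, mfact_single, mfact_single, ← hFm, abs_pow,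
        Real.mul_rpow (by positivity) (by positivity)] at this
      refine this.trans_eq ?_
      simp only [B, hD]
      ring
  calc ‖(𝓕 F) η‖ ≤ ∫ x, ‖F x‖ := by
        rw [SchwartzMap.fourier_coe, Real.fourier_eq']
        refine (norm_integral_le_integral_norm _).trans_eq (integral_congr_ae (.of_forall fun x => ?_))
        simp [Complex.norm_exp]
    _ ≤ ∫ x : Ed d, ((1 + d) ^ N * (M * D + M * B * D)) * (1 + ‖x‖) ^ (-(N : ℝ)) := by
        refine integral_mono F.integrable.norm (hint.const_mul _) fun x => ?_
        have hx : 0 < 1 + ‖x‖ := by positivity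
        simp only [Real.rpow_neg hx.le, Real.rpow_natCast]
        rw [← div_eq_mul_inv, le_div_iff₀ (by positivity), mul_comm]
        exact hFbound x
    _ = (1 + d) ^ N * (M + M * B) * J * D := by
        rw [integral_const_mul]
        ring
    _ ≤ _ := by
        gcongr
        linarith

end FourierTransform

lemma exp_mul_le_of_pow_mul_le_factorial {s a h C G : ℝ} (hs : 0 < s) (ha : 0 ≤ a) (hh : 0 < h)
    (hC : 0 ≤ C) (hG : 0 ≤ G)
    (H : ∀ n : ℕ, a ^ n * G ≤ C * (h ^ n * (n.factorial : ℝ) ^ s)) :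
    Real.exp (s / 2 * (a / h) ^ (1 / s)) * G ≤ 2 ^ s * C := by
  set t := (a / h) ^ (1 / s) with ht
  have ht0 : 0 ≤ t := by positivity
  have hterm (n : ℕ) : (t / 2) ^ n / n.factorial * G ^ (1 / s) ≤ C ^ (1 / s) * (1 / 2) ^ n := by
    have h1 : (a / h) ^ n * G ≤ C * (n.factorial : ℝ) ^ s := by
      rw [div_pow, div_mul_eq_mul_div, div_le_iff₀ (by positivity)]
      linarith [H n]
    have h2 := Real.rpow_le_rpow (by positivity) h1 (one_div_pos.mpr hs).le
    rw [Real.mul_rpow (by positivity) hG, Real.mul_rpow hC (by positivity), ← Real.rpow_mul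
      (by positivity), mul_one_div_cancel hs.ne', Real.rpow_one, ← Real.rpow_natCast,
      ← Real.rpow_mul (by positivity), mul_comm (n : ℝ), Real.rpow_mul (by positivity),
      Real.rpow_natCast, ← ht] at h2
    have hfac : (0 : ℝ) < n.factorial := by positivity
    rw [div_pow, div_div, div_mul_eq_mul_div, div_le_iff₀ (by positivity)]
    refine h2.trans_eq ?_
    rw [one_div_pow]
    field_simp
  have hsum1 : HasSum (fun n : ℕ => (t / 2) ^ n / n.factorial * G ^ (1 / s))
      (Real.exp (t / 2) * G ^ (1 / s)) := by
    have := NormedSpace.expSeries_div_hasSum_exp (t / 2)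
    rw [← Real.exp_eq_exp_ℝ] at this
    exact this.mul_right _
  have hsum2 : HasSum (fun n : ℕ => C ^ (1 / s) * (1 / 2 : ℝ) ^ n) (C ^ (1 / s) * 2) :=
    hasSum_geometric_two.mul_left _
  have hle := Real.rpow_le_rpow (by positivity) (hasSum_le hterm hsum1 hsum2) hs.le
  rw [Real.mul_rpow (by positivity) (by positivity), Real.mul_rpow (by positivity) (by positivity),
    ← Real.rpow_mul hG, ← Real.rpow_mul hC, one_div_mul_cancel hs.ne', Real.rpow_one,
    Real.rpow_one, ← Real.exp_mul] at hle
  calc _ = Real.exp (t / 2 * s) * G := by ring_nf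
    _ ≤ _ := by linarith

section ExponentialDecay

variable {d : ℕ}

lemma exists_fourier_exp_decay {s A : ℝ} (hs : 0 < s) (hA : 0 < A) {f : Ed d → ℂ}
    (hf : f ∈ SigmaGS s d) :
    ∃ C, ∀ ξ : Ed d, Real.exp (A * ‖ξ‖ ^ (1 / s)) *
      ‖(𝓕 (SigmaGS.toSchwartzMap hf)) (-(2 * Real.pi)⁻¹ • ξ)‖ ≤ C := by
  set Φ := SigmaGS.toSchwartzMap hf
  let h : ℝ := (s / 2 / A) ^ s / (d + 1)
  have hh : 0 < h := by positivity
  obtain ⟨C, hC0, hC⟩ := exists_fourier_bound (s := s) hh Φ (hf.2 h hh)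
  refine ⟨2 ^ s * C + ‖(𝓕 Φ) 0‖, fun ξ => ?_⟩
  rcases eq_zero_or_exists_norm_le_mul_abs_coord ξ with rfl | ⟨j, hj⟩
  · have : (0 : ℝ) ^ (1 / s) = 0 := Real.zero_rpow (one_div_pos.mpr hs).ne'
    simp only [norm_zero, smul_zero, this, mul_zero, Real.exp_zero, one_mul]
    have : 0 < (2 : ℝ) ^ s * C := by positivity
    linarith
  · have hcoord : 2 * Real.pi * |(-(2 * Real.pi)⁻¹ • ξ) j| = |ξ j| := by
      simp [abs_mul, abs_of_pos Real.pi_pos]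
      field_simp
    have key := exp_mul_le_of_pow_mul_le_factorial hs (abs_nonneg (ξ j)) hh hC0.le
      (norm_nonneg ((𝓕 Φ) (-(2 * Real.pi)⁻¹ • ξ))) fun n => by
        simpa only [hcoord] using hC j n (-(2 * Real.pi)⁻¹ • ξ)
    have hle : A * ‖ξ‖ ^ (1 / s) ≤ s / 2 * (|ξ j| / h) ^ (1 / s) := by
      have h1 : ‖ξ‖ ≤ (s / 2 / A) ^ s * (|ξ j| / h) := by
        have : (s / 2 / A) ^ s * (|ξ j| / h) = (d + 1) * |ξ j| := by
          simp only [h]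
          field_simp
        rw [this]
        nlinarith [abs_nonneg (ξ j)]
      calc A * ‖ξ‖ ^ (1 / s) ≤ A * ((s / 2 / A) ^ s * (|ξ j| / h)) ^ (1 / s) := by gcongr
        _ = A * (s / 2 / A * (|ξ j| / h) ^ (1 / s)) := by
          rw [Real.mul_rpow (by positivity) (by positivity), ← Real.rpow_mul (by positivity),
            mul_one_div_cancel hs.ne', Real.rpow_one]
        _ = _ := by field_simp
    calc _ ≤ _ := mul_le_mul_of_nonneg_right (Real.exp_le_exp.mpr hle) (norm_nonneg _)
      _ ≤ _ := key.trans (by simp)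

end ExponentialDecay

theorem statement9 (d : ℕ) (s : ℝ) (hs : 1/2 < s)
    (u : TD d) (hu : ∀ g : SchwartzMap (Ed d) ℂ, u g = ∫ x : Ed d, g x)
    (φ : Ed d → ℂ) (hφ : φ ∈ SigmaGS s d) (hφ0 : φ ≠ 0)
    (W : Ed d × Ed d → ℂ) (hW : IsSTFT u φ W) :
    WFs s W = {z : Ed d × Ed d | z.2 = 0 ∧ z.1 ≠ 0} := by
  have hs0 : 0 < s := by linarith
  set Φ := SigmaGS.toSchwartzMap hφ
  have hWn : ∀ z, ‖W z‖ = ‖(𝓕 Φ) (-(2 * Real.pi)⁻¹ • z.2)‖ := norm_STFT_one hu Φ hW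
  ext ⟨x₀, ξ₀⟩
  simp only [WFs, Set.mem_ofPred_eq]
  constructor
  · rintro ⟨hz, hno⟩
    by_cases hξ : ξ₀ = 0
    · exact ⟨hξ, fun hx => hz (by simp [hx, hξ])⟩
    refine absurd ?_ hno
    have hξ' : 0 < ‖ξ₀‖ := norm_pos_iff.mpr hξ
    let c : ℝ := ‖x₀‖ / ‖ξ₀‖ + 1
    have hc : 0 < c := by positivity
    refine ⟨{z | ‖z.1‖ < c * ‖z.2‖}, isOpen_lt (by fun_prop) (by fun_prop), ?_, by simp, ?_, ?_⟩
    · intro t ht z hz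
      simp only [Set.mem_ofPred_eq, Prod.smul_fst, Prod.smul_snd, norm_smul, Real.norm_eq_abs,
        abs_of_pos ht] at hz ⊢
      nlinarith
    · simp only [Set.mem_ofPred_eq, c, add_mul, div_mul_cancel₀ _ hξ'.ne']
      linarith
    · intro A hA
      obtain ⟨C, hC⟩ := exists_fourier_exp_decay hs0
        (A := A * (c + 1) ^ (1 / s)) (by positivity) hφ
      refine ⟨C, fun z hz => le_trans ?_ (hC z.2)⟩
      have hp : pnorm z ≤ (c + 1) * ‖z.2‖ := by
        refine Real.sqrt_le_iff.mpr ⟨by positivity, ?_⟩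
        have h1 : ‖z.1‖ ^ 2 ≤ (c * ‖z.2‖) ^ 2 := by
          gcongr
          exact le_of_lt hz
        nlinarith [mul_nonneg hc.le (sq_nonneg ‖z.2‖)]
      rw [hWn, mul_assoc A, ← Real.mul_rpow (by positivity) (norm_nonneg _)]
      have : 0 ≤ pnorm z := Real.sqrt_nonneg _
      gcongr
  · rintro ⟨rfl, hx⟩
    refine ⟨fun h => hx (congrArg Prod.fst h), ?_⟩
    rintro ⟨Γ, hΓo, hΓc, -, hmem, hbound⟩
    obtain ⟨C, hC⟩ := hbound 1 one_pos
    have hx' : 0 < ‖x₀‖ := norm_pos_iff.mpr hx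
    have hzero (ξ : Ed d) : (𝓕 Φ) (-(2 * Real.pi)⁻¹ • ξ) = 0 := by
      by_contra hne
      have hpos := norm_pos_iff.mpr hne
      have htend : Tendsto (fun t : ℝ => (x₀, t⁻¹ • ξ)) atTop (nhds (x₀, 0)) := by
        refine tendsto_const_nhds.prodMk_nhds ?_
        simpa using (tendsto_inv_atTop_zero (𝕜 := ℝ)).smul_const ξ
      have hexp : Tendsto (fun t : ℝ => Real.exp ((t * ‖x₀‖) ^ (1 / s)) *
          ‖(𝓕 Φ) (-(2 * Real.pi)⁻¹ • ξ)‖) atTop atTop :=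
        (Real.tendsto_exp_atTop.comp ((tendsto_rpow_atTop (one_div_pos.mpr hs0)).comp
          (tendsto_id.atTop_mul_const hx'))).atTop_mul_const hpos
      obtain ⟨t, ht1, ht2, ht3⟩ := ((htend.eventually (hΓo.mem_nhds hmem)).and
        ((hexp.eventually_gt_atTop C).and (eventually_gt_atTop 0))).exists
      have hmem' : (t • x₀, ξ) ∈ Γ := by
        have := hΓc t ht3 _ ht1
        rwa [Prod.smul_mk, smul_inv_smul₀ ht3.ne'] at this
      have hp : t * ‖x₀‖ ≤ pnorm (t • x₀, ξ) := by
        refine Real.le_sqrt_of_sq_le ?_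
        simp only [norm_smul, Real.norm_eq_abs, abs_of_pos ht3]
        nlinarith [sq_nonneg ‖ξ‖]
      have h1 := hC _ hmem'
      rw [hWn, one_mul] at h1
      refine absurd (ht2.trans_le (le_trans ?_ h1)) (lt_irrefl _)
      gcongr
    have hF : 𝓕 Φ = 0 := by
      ext η
      have := hzero (-(2 * Real.pi) • η)
      rwa [smul_smul, neg_mul_neg, inv_mul_cancel₀ (by positivity), one_smul] at this
    have hΦ0 : Φ = 0 := by
      have := FourierTransform.fourierInv_fourier_eq (F := 𝓢(Ed d, ℂ)) Φ
      rw [← this, hF]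
      exact map_zero (FourierTransform.fourierInvCLM ℂ 𝓢(Ed d, ℂ))
    exact hφ0 (congrArg DFunLike.coe hΦ0)

end
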